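/- Let (X, ‖·‖) be a real Banach space and J : X → ℝ a C¹ (Fréchet differentiable with continuous derivative) functional of the form J(u) = (1/q)‖u‖^q − B(u), for some q > 0 and some continuous functional B : X → ℝ. Assume there exists a sequence of continuous maps ψ_n : X → X and real numbers α_n > β_n > 0 such that, for all n and all u ∈ X, ‖u‖^q ≥ α_n‖ψ_n(u)‖^q and B(u) ≤ β_n B(ψ_n(u)); and that lim α_n = lim β_n = 1 and liminf_{n→∞} |1−β_n|/(α_n−β_n) < ∞. Suppose moreover there exist r > 0 and ū ∈ X with ‖ū‖ > r such that inf_{‖u‖=r} J(u) > J(0) ≥ J(ū), lim_{n→∞} ‖ψ_n(0)‖ = 0 and lim_{n→∞} ‖ψ_n(ū) − ū‖ = 0. Then there exists a bounded sequence {w_n} ⊂ X with J(w_n) → c and ‖J'(w_n)‖_{X*} → 0, where c := inf_{γ ∈ Γ} max_{t ∈ [0,1]} J(γ(t)) and Γ := {γ ∈ C([0,1]; X) : γ(0) = 0, γ(1) = ū}. -/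

import Mathlib

open Filter Set Topology

noncomputable section

lemma ekeland_aux {E : Type*} [MetricSpace E] [CompleteSpace E] (f : E → ℝ)
    (hf : LowerSemicontinuous f) (m : ℝ) (hm : ∀ x, m ≤ f x) (ε : ℝ) (hε : 0 < ε) (x0 : E) :
    ∃ x, f x + ε * dist x0 x ≤ f x0 ∧ ∀ y, f x ≤ f y + ε * dist x y := by
  let S : E → Set E := fun x => {y | f y + ε * dist x y ≤ f x}
  have hSself : ∀ x, x ∈ S x := fun x => by simp [S]
  have hStrans : ∀ x y z, y ∈ S x → z ∈ S y → z ∈ S x := by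
    intro x y z hy hz
    simp only [S, mem_ofPred_eq] at *
    nlinarith [dist_triangle x y z]
  let g : E → ℝ := fun x => sInf (f '' S x)
  have hbdd : ∀ x, BddBelow (f '' S x) := fun x => ⟨m, by rintro _ ⟨y, _, rfl⟩; exact hm y⟩
  have hg : ∀ x y, y ∈ S x → g x ≤ f y := fun x y hy => csInf_le (hbdd x) ⟨y, hy, rfl⟩
  have hgmono : ∀ x y, y ∈ S x → g x ≤ g y := by
    intro x y hy
    apply le_csInf (Set.Nonempty.image f ⟨y, hSself y⟩)
    rintro _ ⟨z, hz, rfl⟩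
    exact hg x z (hStrans x y z hy hz)
  have hnext : ∀ x, ∃ y, y ∈ S x ∧ f y - g x ≤ (f x - g x) / 2 := by
    intro x
    rcases eq_or_lt_of_le (hg x x (hSself x)) with h | h
    · exact ⟨x, hSself x, by linarith⟩
    · obtain ⟨_, ⟨y, hy, rfl⟩, hy2⟩ := exists_lt_of_csInf_lt (s := f '' S x) (b := (f x + g x) / 2)
        ⟨f x, x, hSself x, rfl⟩ (by change g x < _; linarith)
      exact ⟨y, hy, by linarith⟩
  choose nx hnx1 hnx2 using hnext
  let u : ℕ → E := fun n => nx^[n] x0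
  have hu : ∀ n, u (n+1) = nx (u n) := fun n => Function.iterate_succ_apply' nx n x0
  have hmem : ∀ n k, u (n + k) ∈ S (u n) := by
    intro n k
    induction k with
    | zero => exact hSself _
    | succ k ih =>
      rw [← add_assoc, hu]
      exact hStrans _ _ _ ih (hnx1 _)
  have hmem' : ∀ n k, n ≤ k → u k ∈ S (u n) := by
    intro n k h
    obtain ⟨d, rfl⟩ := Nat.exists_eq_add_of_le h
    exact hmem n d
  have hgap : ∀ n, f (u n) - g (u n) ≤ (1/2)^n * (f x0 - g x0) := by
    intro n
    induction n with
    | zero => simp [u]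
    | succ n ih =>
      have h1 := hnx2 (u n)
      have h2 := hgmono _ _ (hnx1 (u n))
      rw [hu, pow_succ]
      linarith
  have hanti : Antitone (fun n => f (u n)) := by
    intro n k h
    have := hmem' n k h
    simp only [S, mem_ofPred_eq] at this
    have h0 : 0 ≤ ε * dist (u n) (u k) := by positivity
    simp only; linarith
  have hconv : ∃ l, Tendsto (fun n => f (u n)) atTop (𝓝 l) :=
    ⟨_, tendsto_atTop_ciInf hanti ⟨m, by rintro _ ⟨n, rfl⟩; exact hm _⟩⟩
  obtain ⟨l, hl⟩ := hconv
  have hlle : ∀ n, l ≤ f (u n) := fun n => hanti.le_of_tendsto hl n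
  have hcau : CauchySeq u := by
    apply cauchySeq_of_le_tendsto_0' (fun n => (f (u n) - l) / ε)
    · intro n k h
      have := hmem' n k h
      simp only [S, mem_ofPred_eq] at this
      rw [le_div_iff₀ hε]
      linarith [hlle k]
    · have := (hl.sub_const l).div_const ε
      simpa using this
  obtain ⟨x, hx⟩ := cauchySeq_tendsto_of_complete hcau
  have hlsc : ∀ a : ℝ, a < f x → ∀ᶠ n in atTop, a < f (u n) := fun a ha => hx.eventually (hf x a ha)
  have hxl : f x ≤ l := by
    by_contra h
    push Not at h
    obtain ⟨a, ha1, ha2⟩ := exists_between h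
    have h1 := hlsc a ha2
    have h2 := hl.eventually (gt_mem_nhds ha1)
    obtain ⟨n, h3, h4⟩ := (h1.and h2).exists
    linarith
  have hxS : ∀ n, x ∈ S (u n) := by
    intro n
    have h1 : Tendsto (fun k => ε * dist (u n) (u k)) atTop (𝓝 (ε * dist (u n) x)) :=
      (tendsto_const_nhds.dist hx).const_mul ε
    have h2 : ε * dist (u n) x ≤ f (u n) - l := by
      apply le_of_tendsto h1
      filter_upwards [eventually_ge_atTop n] with k hk
      have := hmem' n k hk
      simp only [S, mem_ofPred_eq] at this
      linarith [hlle k]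
    simp only [S, mem_ofPred_eq]
    linarith
  refine ⟨x, hxS 0, fun y => ?_⟩
  by_contra h
  push Not at h
  have hy : y ∈ S x := by simp only [S, mem_ofPred_eq]; exact h.le
  have h1 : ∀ n, f x - f y ≤ (1/2)^n * (f x0 - g x0) := by
    intro n
    have h2 := hg _ _ (hStrans _ _ _ (hxS n) hy)
    linarith [hgap n, hlle n]
  have h2 : Tendsto (fun n : ℕ => ((1:ℝ)/2)^n * (f x0 - g x0)) atTop (𝓝 (0 * (f x0 - g x0))) :=
    (tendsto_pow_atTop_nhds_zero_of_lt_one (by norm_num) (by norm_num)).mul_const _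
  have h3 := ge_of_tendsto' h2 h1
  have h0 : 0 ≤ ε * dist x y := by positivity
  linarith

open unitInterval

lemma minimax_aux (X : Type*) [NormedAddCommGroup X] [NormedSpace ℝ X] [CompleteSpace X]
    (J : X → ℝ) (hJ : ContDiff ℝ 1 J) (c δ η M : ℝ) (hδ : 0 < δ) (hη : 0 < η) (ubar : X)
    (hc : ∀ f : C(I, X), f 0 = 0 → f 1 = ubar → ∃ t, c ≤ J (f t))
    (hJ0 : J 0 ≤ c - δ) (hJu : J ubar ≤ c - δ)
    (f0 : C(I, X)) (h00 : f0 0 = 0) (h01 : f0 1 = ubar)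
    (hsup : ∀ t, J (f0 t) ≤ c + η) (hM : ∀ t, c - δ < J (f0 t) → ‖f0 t‖ ≤ M) :
    ∃ w, ‖w‖ ≤ M + 1 ∧ c - δ ≤ J w ∧ J w ≤ c + η ∧ ‖fderiv ℝ J w‖ ≤ 2 * η := by
  have hJc : Continuous J := hJ.continuous
  have hJ' : Continuous (fderiv ℝ J) := hJ.continuous_fderiv (by norm_num)
  let T : Set I := {t | J (f0 t) ≤ c - δ}
  have hT : IsClosed T := isClosed_le (by fun_prop) continuous_const
  have h0T : (0:I) ∈ T := by simpa [T, h00] using hJ0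
  have h1T : (1:I) ∈ T := by simpa [T, h01] using hJu
  let S : Set C(I, X) := {f | ∀ t ∈ T, f t = f0 t}
  have hS : IsClosed S := by
    have : S = ⋂ t ∈ T, {f : C(I,X) | f t = f0 t} := by ext; simp [S]
    rw [this]
    exact isClosed_biInter fun t _ => isClosed_eq (continuous_eval_const t) continuous_const
  have : CompleteSpace S := hS.completeSpace_coe
  have hcS : ∀ f ∈ S, ∃ t, c ≤ J (f t) := fun f hf =>
    hc f ((hf 0 h0T).trans h00) ((hf 1 h1T).trans h01)
  let Φ : C(I, X) → ℝ := fun f => ⨆ t, J (f t)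
  have hbdd : ∀ f : C(I, X), BddAbove (range fun t => J (f t)) := fun f =>
    (isCompact_range (by fun_prop)).bddAbove
  have hΦ : ∀ (f : C(I,X)) t, J (f t) ≤ Φ f := fun f t => le_ciSup (hbdd f) t
  have hlsc : LowerSemicontinuous (fun f : S => Φ f.1) := by
    refine lowerSemicontinuous_ciSup (f := fun (t : I) (f : S) => J (f.1 t)) (fun f => hbdd f.1) ?_
    intro t
    exact (hJc.comp ((continuous_eval_const t).comp continuous_subtype_val)).lowerSemicontinuous
  obtain ⟨⟨f, hfS⟩, hf1, hf2⟩ := ekeland_aux (fun f : S => Φ f.1) hlsc c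
    (fun f => by obtain ⟨t, ht⟩ := hcS f.1 f.2; exact ht.trans (hΦ f.1 t)) η hη ⟨f0, fun t _ => rfl⟩
  simp only [Subtype.dist_eq, Subtype.forall] at hf1 hf2
  have hΦ0 : Φ f0 ≤ c + η := ciSup_le hsup
  have hΦc : c ≤ Φ f := by obtain ⟨t, ht⟩ := hcS f hfS; exact ht.trans (hΦ f t)
  have hd : dist f0 f ≤ 1 := by nlinarith
  have hd0 : 0 ≤ η * dist f0 f := by positivity
  let K : Set I := {t | c - δ / 2 ≤ J (f t)}
  have hK : IsClosed K := isClosed_le continuous_const (by fun_prop)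
  have hKT : ∀ t ∈ K, t ∉ T := by
    intro t ht htT
    have := hfS t htT
    simp only [K, T, mem_ofPred_eq] at ht htT
    rw [this] at ht
    linarith
  by_contra hcon
  push Not at hcon
  have hbig : ∀ t ∈ K, 2 * η < ‖fderiv ℝ J (f t)‖ := by
    intro t ht
    have h1 := hKT t ht
    simp only [T, mem_ofPred_eq, not_le] at h1
    have h2 := hM t h1
    have h3 : ‖f t‖ ≤ M + 1 := by
      have h4 := (ContinuousMap.dist_apply_le_dist (f := f0) (g := f) t).trans hd
      rw [dist_comm, dist_eq_norm] at h4
      have := norm_add_le (f t - f0 t) (f0 t)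
      simp only [sub_add_cancel] at this
      linarith
    simp only [K, mem_ofPred_eq] at ht
    exact hcon _ h3 (by linarith) (by linarith [hΦ f t])
  have hvec : ∀ t ∈ K, ∃ v : X, ‖v‖ ≤ 1 ∧ fderiv ℝ J (f t) v < -(2 * η) := by
    intro t ht
    obtain ⟨v, hv1, hv2⟩ := ContinuousLinearMap.exists_lt_apply_of_lt_opNorm _ (hbig t ht)
    rw [Real.norm_eq_abs] at hv2
    rcases lt_abs.1 hv2 with h | h
    · exact ⟨-v, by rw [norm_neg]; exact hv1.le, by rw [map_neg]; linarith⟩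
    · exact ⟨v, hv1.le, by linarith⟩
  obtain ⟨v, hv⟩ := exists_continuous_forall_mem_convex_of_local_const
    (t := fun t : I => {v : X | ‖v‖ ≤ 1} ∩ ({v | t ∈ K → fderiv ℝ J (f t) v < -(2 * η)} ∩ {v | t ∈ T → v = 0}))
    (by
      intro t
      refine Convex.inter ?_ (Convex.inter ?_ ?_)
      · have := convex_closedBall (0:X) 1
        convert this using 1
        ext; simp
      · by_cases ht : t ∈ K
        · simp only [ht, true_imp_iff]
          exact convex_halfSpace_lt (fderiv ℝ J (f t)).isLinear _
        · simp [ht, convex_univ]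
      · by_cases ht : t ∈ T
        · simp [ht, convex_singleton]
        · simp [ht, convex_univ])
    (by
      intro t
      by_cases ht : t ∈ K
      · obtain ⟨v, hv1, hv2⟩ := hvec t ht
        refine ⟨v, ?_⟩
        have h1 : ∀ᶠ s in 𝓝 t, s ∉ T := hT.isOpen_compl.mem_nhds (hKT t ht)
        have hcont : Continuous (fun s => fderiv ℝ J (f s) v) := by fun_prop
        have h2 : ∀ᶠ s in 𝓝 t, fderiv ℝ J (f s) v < -(2 * η) :=
          hcont.continuousAt.eventually (gt_mem_nhds hv2)
        filter_upwards [h1, h2] with s hs1 hs2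
        exact ⟨hv1, fun _ => hs2, fun h => absurd h hs1⟩
      · refine ⟨0, ?_⟩
        have h1 : ∀ᶠ s in 𝓝 t, s ∉ K := hK.isOpen_compl.mem_nhds ht
        filter_upwards [h1] with s hs1
        exact ⟨by simp, fun h => absurd h hs1, fun _ => rfl⟩)
  have hv1 : ∀ t, ‖v t‖ ≤ 1 := fun t => (hv t).1
  have hv2 : ∀ t ∈ K, fderiv ℝ J (f t) (v t) < -(2 * η) := fun t => (hv t).2.1
  have hv3 : ∀ t ∈ T, v t = 0 := fun t => (hv t).2.2
  let P : Set (ℝ × I) := {p | (fderiv ℝ J (f p.2 + p.1 • v p.2) (v p.2) < -(2 * η) ∨ p.2 ∈ Kᶜ) ∧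
    (J (f p.2 + p.1 • v p.2) < c ∨ c - δ / 2 < J (f p.2))}
  have hP : IsOpen P := by
    have c1 : Continuous (fun p : ℝ × I => fderiv ℝ J (f p.2 + p.1 • v p.2) (v p.2)) := by fun_prop
    have c2 : Continuous (fun p : ℝ × I => J (f p.2 + p.1 • v p.2)) := by fun_prop
    have c3 : Continuous (fun p : ℝ × I => J (f p.2)) := by fun_prop
    refine IsOpen.inter (IsOpen.union (isOpen_lt c1 continuous_const)
      (hK.isOpen_compl.preimage continuous_snd)) (IsOpen.union (isOpen_lt c2 continuous_const)
      (isOpen_lt continuous_const c3))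
  obtain ⟨U, V, hU, -, hU0, hV, hUV⟩ := generalized_tube_lemma (s := {(0:ℝ)}) isCompact_singleton
    (t := (univ : Set I)) isCompact_univ hP (by
      rintro ⟨s, t⟩ ⟨hs, -⟩
      simp only [mem_singleton_iff] at hs
      subst hs
      refine ⟨?_, ?_⟩
      · by_cases ht : t ∈ K
        · left; simpa using hv2 t ht
        · right; exact ht
      · simp only [zero_smul, add_zero]
        by_cases h : J (f t) < c
        · exact Or.inl h
        · right; linarith)
  obtain ⟨s0, hs0, hs0U⟩ := Metric.isOpen_iff.1 hU 0 (hU0 rfl)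
  have hPs : ∀ s t, 0 ≤ s → s < s0 → ((s, t) : ℝ × I) ∈ P := by
    intro s t h1 h2
    exact hUV ⟨hs0U (by simp [abs_of_nonneg h1, h2]), hV (mem_univ t)⟩
  set s := s0 / 2 with hs
  have hspos : 0 < s := by positivity
  let e : C(I, X) := ⟨fun t => f t + s • v t, by fun_prop⟩
  have heS : e ∈ S := by
    intro t ht
    change f t + s • v t = f0 t
    rw [hv3 t ht, hfS t ht]; simp
  have hde : dist f e ≤ s := by
    rw [ContinuousMap.dist_le hspos.le]
    intro t
    change dist (f t) (f t + s • v t) ≤ s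
    rw [dist_self_add_right, norm_smul, Real.norm_of_nonneg hspos.le]
    nlinarith [hv1 t]
  obtain ⟨t, -, ht⟩ := isCompact_univ.exists_isMaxOn (univ_nonempty (α := I)) (f := fun t => J (e t))
    (by fun_prop)
  have hte : Φ e ≤ J (e t) := ciSup_le fun x => ht (mem_univ x)
  have htc : c ≤ J (e t) := by
    obtain ⟨t', ht'⟩ := hcS e heS
    exact ht'.trans (ht (mem_univ t'))
  have htK : t ∈ K := by
    rcases (hPs s t hspos.le (by linarith)).2 with h | h
    · exact absurd htc (not_le.2 h)
    · exact h.le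
  have hmv : J (e t) ≤ J (f t) - 2 * η * s := by
    have hder : ∀ x : ℝ, HasDerivAt (fun x : ℝ => J (f t + x • v t))
        (fderiv ℝ J (f t + x • v t) (v t)) x := by
      intro x
      have h1 : HasFDerivAt J (fderiv ℝ J (f t + x • v t)) (f t + x • v t) :=
        (hJ.differentiable (by norm_num) _).hasFDerivAt
      have h2 : HasDerivAt (fun x : ℝ => f t + x • v t) (v t) x := by
        simpa using ((hasDerivAt_id x).smul_const (v t)).const_add (f t)
      exact h1.comp_hasDerivAt x h2
    obtain ⟨x, hx, hx2⟩ := exists_hasDerivAt_eq_slope (fun x : ℝ => J (f t + x • v t)) _ hspos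
      (fun x _ => (hder x).continuousAt.continuousWithinAt) (fun x _ => hder x)
    have h3 := (hPs x t hx.1.le (by linarith [hx.2])).1.resolve_right (fun h => h htK)
    simp only at h3
    rw [hx2, div_lt_iff₀ (by linarith)] at h3
    simp only [zero_smul, add_zero, sub_zero] at h3
    change J (f t + s • v t) ≤ _
    linarith
  have h5 := hf2 e heS
  have h6 := hΦ f t
  nlinarith

lemma sphere_bdd_aux
    (X : Type*) [NormedAddCommGroup X] [NormedSpace ℝ X]
    (J B : X → ℝ) (q : ℝ) (hq : 0 < q) (hB : Continuous B)
    (hform : ∀ u : X, J u = (1 / q) * ‖u‖ ^ q - B u)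
    (φ : X → X) (a b : ℝ) (hb : 0 < b) (hba : b < a) (hφ0 : φ 0 = 0)
    (h1 : ∀ u : X, a * ‖φ u‖ ^ q ≤ ‖u‖ ^ q)
    (h2 : ∀ u : X, B u ≤ b * B (φ u))
    (r : ℝ) (hr : 0 < r)
    (hmp1 : J 0 < sInf {m : ℝ | ∃ u : X, ‖u‖ = r ∧ m = J u}) :
    BddBelow {m : ℝ | ∃ u : X, ‖u‖ = r ∧ m = J u} := by
  by_contra hn
  rw [Real.sInf_of_not_bddBelow hn] at hmp1
  apply hn
  have hB0 : 0 < B 0 := by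
    have := hform 0
    rw [norm_zero, Real.zero_rpow hq.ne'] at this
    linarith
  have hb1 : 1 ≤ b := by
    have := h2 0
    rw [hφ0] at this
    by_contra h
    push Not at h
    nlinarith
  have ha1 : 1 < a := by linarith
  have ha0 : 0 < a := by linarith
  have hit1 : ∀ k u, a ^ k * ‖φ^[k] u‖ ^ q ≤ ‖u‖ ^ q := by
    intro k
    induction k with
    | zero => intro u; simp
    | succ k ih =>
      intro u
      rw [Function.iterate_succ_apply, pow_succ']
      calc a * a ^ k * ‖φ^[k] (φ u)‖ ^ q = a * (a ^ k * ‖φ^[k] (φ u)‖ ^ q) := by ring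
        _ ≤ a * ‖φ u‖ ^ q := by gcongr; exact ih _
        _ ≤ _ := h1 u
  have hit2 : ∀ k u, B u ≤ b ^ k * B (φ^[k] u) := by
    intro k
    induction k with
    | zero => intro u; simp
    | succ k ih =>
      intro u
      rw [Function.iterate_succ_apply, pow_succ']
      calc B u ≤ b * B (φ u) := h2 u
        _ ≤ b * (b ^ k * B (φ^[k] (φ u))) := by gcongr; exact ih _
        _ = _ := by ring
  obtain ⟨s, hs, hsB⟩ := Metric.eventually_nhds_iff.1
    (hB.continuousAt.eventually (gt_mem_nhds (show B 0 < B 0 + 1 by linarith)))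
  have hsq : 0 < s ^ q := by positivity
  obtain ⟨k, hk⟩ := pow_unbounded_of_one_lt (r ^ q / s ^ q) ha1
  rw [div_lt_iff₀ hsq] at hk
  refine ⟨-(b ^ k * (B 0 + 1)), ?_⟩
  rintro _ ⟨u, hu, rfl⟩
  have h3 := hit1 k u
  rw [hu] at h3
  have h4 : ‖φ^[k] u‖ < s := by
    rw [← Real.rpow_lt_rpow_iff (norm_nonneg _) hs.le hq]
    exact lt_of_mul_lt_mul_left (h3.trans_lt hk) (by positivity)
  have h5 : B (φ^[k] u) < B 0 + 1 := hsB (by simpa using h4)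
  have h6 := hit2 k u
  have h7 : b ^ k * B (φ^[k] u) ≤ b ^ k * (B 0 + 1) := by gcongr
  rw [hform u]
  have h8 : 0 ≤ 1 / q * ‖u‖ ^ q := by positivity
  linarith

theorem bounded_palais_smale_sequence
    (X : Type*) [NormedAddCommGroup X] [NormedSpace ℝ X] [CompleteSpace X]
    (J B : X → ℝ) (q : ℝ) (hq : 0 < q)
    (hJ : ContDiff ℝ 1 J) (hB : Continuous B)
    (hform : ∀ u : X, J u = (1 / q) * ‖u‖ ^ q - B u)
    (ψ : ℕ → X → X) (hψ : ∀ n, Continuous (ψ n))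
    (a b : ℕ → ℝ) (hb : ∀ n, 0 < b n) (hba : ∀ n, b n < a n)
    (h1 : ∀ n, ∀ u : X, a n * ‖ψ n u‖ ^ q ≤ ‖u‖ ^ q)
    (h2 : ∀ n, ∀ u : X, B u ≤ b n * B (ψ n u))
    (ha : Tendsto a atTop (𝓝 1)) (hbl : Tendsto b atTop (𝓝 1))
    (hliminf : liminf (fun n => ((|1 - b n| / (a n - b n) : ℝ) : EReal)) atTop < (⊤ : EReal))
    (r : ℝ) (hr : 0 < r) (ubar : X) (hubar : r < ‖ubar‖)
    (hmp1 : J 0 < sInf {m : ℝ | ∃ u : X, ‖u‖ = r ∧ m = J u})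
    (hmp2 : J ubar ≤ J 0)
    (hψ0 : Tendsto (fun n => ‖ψ n 0‖) atTop (𝓝 0))
    (hψu : Tendsto (fun n => ‖ψ n ubar - ubar‖) atTop (𝓝 0)) :
    ∃ w : ℕ → X, (∃ Cb : ℝ, ∀ n, ‖w n‖ ≤ Cb) ∧
      Tendsto (fun n => J (w n)) atTop
        (𝓝 (sInf {m : ℝ | ∃ γ : ℝ → X, ContinuousOn γ (Icc (0:ℝ) 1) ∧
          γ 0 = 0 ∧ γ 1 = ubar ∧ m = ⨆ t : Icc (0:ℝ) 1, J (γ t)})) ∧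
      Tendsto (fun n => ‖fderiv ℝ J (w n)‖) atTop (𝓝 0) := by
  have hJc : Continuous J := hJ.continuous
  have hψz : ∀ n, ψ n 0 = 0 := by
    intro n
    have h := h1 n 0
    rw [norm_zero, Real.zero_rpow hq.ne'] at h
    have h' : ‖ψ n 0‖ ^ q ≤ 0 := by
      by_contra hc
      push Not at hc
      have := mul_pos ((hb n).trans (hba n)) hc
      linarith
    by_contra hne
    have : 0 < ‖ψ n 0‖ ^ q := Real.rpow_pos_of_pos (norm_pos_iff.2 hne) q
    linarith
  have hsph := sphere_bdd_aux X J B q hq hB hform (ψ 0) (a 0) (b 0) (hb 0) (hba 0) (hψz 0)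
    (h1 0) (h2 0) r hr hmp1
  set Γ := {m : ℝ | ∃ γ : ℝ → X, ContinuousOn γ (Icc (0:ℝ) 1) ∧
          γ 0 = 0 ∧ γ 1 = ubar ∧ m = ⨆ t : Icc (0:ℝ) 1, J (γ t)} with hΓ
  set c := sInf Γ with hcdef
  set m0 := sInf {m : ℝ | ∃ u : X, ‖u‖ = r ∧ m = J u} with hm0
  have hbdd : ∀ f : C(I, X), BddAbove (range fun t => J (f t)) := fun f =>
    (isCompact_range (by fun_prop)).bddAbove
  have hΓfwd : ∀ m ∈ Γ, ∃ f : C(I, X), f 0 = 0 ∧ f 1 = ubar ∧ m = ⨆ t, J (f t) := by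
    rintro m ⟨γ, h1, h2, h3, rfl⟩
    exact ⟨⟨fun t => γ t, h1.domRestrict⟩, h2, h3, rfl⟩
  have hΓbwd : ∀ f : C(I, X), f 0 = 0 → f 1 = ubar → (⨆ t, J (f t)) ∈ Γ := by
    intro f h0 h1
    refine ⟨IccExtend zero_le_one f, (f.continuous.Icc_extend').continuousOn, ?_, ?_, ?_⟩
    · rw [IccExtend_left]; exact h0
    · rw [IccExtend_right]; exact h1
    · simp
  have hcross : ∀ f : C(I, X), f 0 = 0 → f 1 = ubar → m0 ≤ ⨆ t, J (f t) := by
    intro f h0 h1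
    have hcont : Continuous (fun t => ‖f t‖) := by fun_prop
    obtain ⟨t, ht⟩ := mem_range_of_exists_le_of_exists_ge (c := r) hcont
      ⟨0, by rw [h0, norm_zero]; exact hr.le⟩ ⟨1, by rw [h1]; exact hubar.le⟩
    exact (csInf_le hsph ⟨f t, ht, rfl⟩).trans (le_ciSup (hbdd f) t)
  have hΓne : Γ.Nonempty := ⟨_, hΓbwd (Path.segment 0 ubar).toContinuousMap (by simp) (by simp)⟩
  have hΓbdd : BddBelow Γ := ⟨m0, by
    intro m hm
    obtain ⟨f, h0, h1, rfl⟩ := hΓfwd m hm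
    exact hcross f h0 h1⟩
  have hm0c : m0 ≤ c := le_csInf hΓne (by
    intro m hm
    obtain ⟨f, h0, h1, rfl⟩ := hΓfwd m hm
    exact hcross f h0 h1)
  have hJ0c : J 0 < c := hmp1.trans_le hm0c
  have hc : ∀ f : C(I, X), f 0 = 0 → f 1 = ubar → ∃ t, c ≤ J (f t) := by
    intro f h0 h1
    obtain ⟨t, -, ht⟩ := isCompact_univ.exists_isMaxOn (univ_nonempty (α := I))
      (f := fun t => J (f t)) (by fun_prop)
    exact ⟨t, (csInf_le hΓbdd (hΓbwd f h0 h1)).trans (ciSup_le fun x => ht (mem_univ x))⟩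
  -- the liminf bound
  obtain ⟨C, hC⟩ : ∃ C : ℝ, ∃ᶠ n in atTop, |1 - b n| / (a n - b n) < C := by
    obtain ⟨C, hC1, hC2⟩ := EReal.lt_iff_exists_real_btwn.1 hliminf
    exact ⟨C, (frequently_lt_of_liminf_lt (h := hC1)).mono fun n hn => by exact_mod_cast hn⟩
  set M := (4 * q * (|c| * C + 3)) ^ (1 / q) with hMdef
  have key : ∀ ε > 0, ∃ w, ‖w‖ ≤ M + 1 ∧ c - ε ≤ J w ∧ J w ≤ c + ε ∧ ‖fderiv ℝ J w‖ ≤ 2 * ε := by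
    intro ε hε
    set d := (c - J 0) / 2 with hd
    have hdpos : 0 < d := by rw [hd]; linarith
    obtain ⟨ρ, hρ, hρJ⟩ := Metric.eventually_nhds_iff_ball.1
      (hJc.continuousAt.eventually (gt_mem_nhds (show J ubar < c - d by rw [hd]; linarith)))
    have e1 : ∀ᶠ n in atTop, a n < 2 := ha.eventually (gt_mem_nhds (by norm_num))
    have e2 : ∀ᶠ n in atTop, 1/2 < a n := ha.eventually (lt_mem_nhds (by norm_num))
    have e3 : ∀ᶠ n in atTop, b n < 2 := hbl.eventually (gt_mem_nhds (by norm_num))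
    have hab : Tendsto (fun n => a n - b n) atTop (𝓝 0) := by simpa using ha.sub hbl
    have e4 : ∀ᶠ n in atTop, a n - b n < d := hab.eventually (gt_mem_nhds hdpos)
    have e5 : ∀ᶠ n in atTop, a n - b n < ε := hab.eventually (gt_mem_nhds hε)
    have e6 : ∀ᶠ n in atTop, (c + (a n - b n)) / b n < c + ε := by
      have : Tendsto (fun n => (c + (a n - b n)) / b n) atTop (𝓝 ((c + 0) / 1)) :=
        (hab.const_add c).div hbl one_ne_zero
      exact this.eventually (gt_mem_nhds (by linarith))
    have e7 : ∀ᶠ n in atTop, ‖ψ n ubar - ubar‖ < ρ := hψu.eventually (gt_mem_nhds hρ)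
    obtain ⟨n, hCn, f1, f2, f3, f4, f5, f6, f7⟩ :=
      (hC.and_eventually (e1.and (e2.and (e3.and (e4.and (e5.and (e6.and e7))))))).exists
    set e := a n - b n with he
    have hepos : 0 < e := sub_pos.2 (hba n)
    have hbn := hb n
    have han : 0 < a n := by linarith
    obtain ⟨_, hmΓ, hmlt⟩ := exists_lt_of_csInf_lt hΓne (show sInf Γ < c + e by linarith)
    obtain ⟨f, hf0, hf1, rfl⟩ := hΓfwd _ hmΓ
    let p1 : Path (0:X) (ψ n ubar) :=
      ⟨⟨fun t => ψ n (f t), (hψ n).comp f.continuous⟩, by simp [hf0, hψz], by simp [hf1]⟩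
    let p : Path (0:X) ubar := p1.trans (Path.segment (ψ n ubar) ubar)
    have hp : ∀ t, (∃ s, p t = ψ n (f s)) ∨ J (p t) < c - d := by
      intro t
      have ht : p t ∈ range p := ⟨t, rfl⟩
      rw [Path.trans_range] at ht
      rcases ht with ⟨s, hs⟩ | ht
      · exact Or.inl ⟨s, hs.symm⟩
      · right
        rw [Path.range_segment] at ht
        apply hρJ
        exact (convex_ball ubar ρ).segment_subset (by simpa [dist_eq_norm] using f7)
          (Metric.mem_ball_self hρ) ht
    have hbase : ∀ u, J u ≤ c + e → b n * J (ψ n u) + e / q * ‖ψ n u‖ ^ q ≤ c + e := by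
      intro u hu
      have g1 := h1 n u
      have g2 := h2 n u
      rw [hform] at hu ⊢
      have g3 : 1 / q * (a n * ‖ψ n u‖ ^ q) ≤ 1 / q * ‖u‖ ^ q := by gcongr
      have g4 : e / q * ‖ψ n u‖ ^ q = 1 / q * (a n * ‖ψ n u‖ ^ q) - b n * (1 / q * ‖ψ n u‖ ^ q) := by
        rw [he]; ring
      rw [g4]
      linarith
    have hfle : ∀ s, J (f s) ≤ c + e := fun s => (le_ciSup (hbdd f) s).trans hmlt.le
    obtain ⟨w, w1, w2, w3, w4⟩ := minimax_aux X J hJ c e ε M hepos hε ubar hc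
      (by rw [hd] at f4; linarith) (by rw [hd] at f4; linarith) p.toContinuousMap (by simp) (by simp)
      (by
        intro t
        change J (p t) ≤ _
        rcases hp t with ⟨s, hs⟩ | h
        · rw [hs]
          have g := hbase _ (hfle s)
          have g1 : 0 ≤ e / q * ‖ψ n (f s)‖ ^ q := by positivity
          have g2 : J (ψ n (f s)) ≤ (c + e) / b n := by
            rw [le_div_iff₀ hbn]; linarith
          linarith
        · linarith)
      (by
        intro t ht
        change c - e < J (p t) at ht
        change ‖p t‖ ≤ M
        rcases hp t with ⟨s, hs⟩ | h
        · rw [hs] at ht ⊢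
          have g := hbase _ (hfle s)
          rw [div_lt_iff₀ hepos] at hCn
          have g1 : c * (1 - b n) ≤ |c| * (C * e) := by
            calc c * (1 - b n) ≤ |c * (1 - b n)| := le_abs_self _
              _ = |c| * |1 - b n| := abs_mul _ _
              _ ≤ _ := by gcongr
          have g2 : b n * (c - e) ≤ b n * J (ψ n (f s)) := by gcongr
          have g3 : e * ‖ψ n (f s)‖ ^ q ≤ e * (q * (|c| * C + 3)) := by
            have : e / q * ‖ψ n (f s)‖ ^ q ≤ e * (|c| * C + 3) := by nlinarith
            calc e * ‖ψ n (f s)‖ ^ q = q * (e / q * ‖ψ n (f s)‖ ^ q) := by field_simp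
              _ ≤ q * (e * (|c| * C + 3)) := by gcongr
              _ = _ := by ring
          have g4 := le_of_mul_le_mul_left g3 hepos
          have g5 : 0 ≤ ‖ψ n (f s)‖ ^ q := by positivity
          have g6 : ‖ψ n (f s)‖ ^ q ≤ 4 * q * (|c| * C + 3) := by nlinarith
          calc ‖ψ n (f s)‖ = (‖ψ n (f s)‖ ^ q) ^ (1 / q) := by
                rw [← Real.rpow_mul (norm_nonneg _), mul_one_div_cancel hq.ne', Real.rpow_one]
            _ ≤ M := Real.rpow_le_rpow g5 g6 (by positivity)
        · linarith)
    exact ⟨w, w1, by linarith, w3, w4⟩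
  have hkey : ∀ k : ℕ, ∃ w, ‖w‖ ≤ M + 1 ∧ c - 1 / ((k:ℝ) + 1) ≤ J w ∧ J w ≤ c + 1 / ((k:ℝ) + 1) ∧
      ‖fderiv ℝ J w‖ ≤ 2 * (1 / ((k:ℝ) + 1)) := fun k => key _ (by positivity)
  choose w w1 w2 w3 w4 using hkey
  have hlim := tendsto_one_div_add_atTop_nhds_zero_nat (𝕜 := ℝ)
  refine ⟨w, ⟨M + 1, w1⟩, ?_, ?_⟩
  · exact tendsto_of_tendsto_of_tendsto_of_le_of_le (by simpa using hlim.const_sub c)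
      (by simpa using hlim.const_add c) w2 w3
  · exact squeeze_zero (fun _ => norm_nonneg _) w4 (by simpa using hlim.const_mul 2)
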